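/- Let A be a right weak bimonoid in a duoidal category (M,∘,I,•,J) in which idempotent morphisms split. Then ⊓^R_∘ is a morphism of right R_∘-comodules; concretely, ((J∘A)•⊓^R_∘).ζ.(J∘Δ).⊓^R_∘ = (⊓^R_∘•(J∘A)).((J∘A)•⊓^R_∘).ζ.(J∘Δ) as morphisms J∘A → (J∘A)•(J∘A). Consequently π^R_∘ and ι^R_∘ are morphisms of right R_∘-comodules, where J∘A carries the coaction ((J∘A)•π^R_∘).ζ.(J∘Δ) : J∘A → (J∘A)•R_∘ and R_∘ carries the coaction Δ^R_∘, and moreover Δ^R_∘ = (π^R_∘•π^R_∘).ζ.(J∘Δ).ι^R_∘. -/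

import Mathlib

open CategoryTheory

universe v u

/-- A (strict) duoidal category structure on a category `M`: two strict monoidal
structures `co` (the first monoidal product `∘` with unit `uI`) and `bu` (the second
monoidal product `•` with unit `uJ`), together with the structure morphisms
`dlI : I ⟶ I • I`, `pw : J ∘ J ⟶ J`, `tau : I ⟶ J` and the interchange law `zt`,
subject to the axioms of a duoidal category. -/
structure Duo (M : Type u) [Category.{v} M] where
  co : M → M → M
  coh : ∀ {X₁ Y₁ X₂ Y₂ : M}, (X₁ ⟶ Y₁) → (X₂ ⟶ Y₂) → (co X₁ X₂ ⟶ co Y₁ Y₂)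
  uI : M
  bu : M → M → M
  buh : ∀ {X₁ Y₁ X₂ Y₂ : M}, (X₁ ⟶ Y₁) → (X₂ ⟶ Y₂) → (bu X₁ X₂ ⟶ bu Y₁ Y₂)
  uJ : M
  coA : ∀ X Y Z, co (co X Y) Z = co X (co Y Z)
  coL : ∀ X, co uI X = X
  coR : ∀ X, co X uI = X
  buA : ∀ X Y Z, bu (bu X Y) Z = bu X (bu Y Z)
  buL : ∀ X, bu uJ X = X
  buR : ∀ X, bu X uJ = X
  coh_id : ∀ X Y, coh (𝟙 X) (𝟙 Y) = 𝟙 (co X Y)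
  coh_comp : ∀ {X₁ Y₁ Z₁ X₂ Y₂ Z₂ : M} (f₁ : X₁ ⟶ Y₁) (g₁ : Y₁ ⟶ Z₁) (f₂ : X₂ ⟶ Y₂)
    (g₂ : Y₂ ⟶ Z₂), coh (f₁ ≫ g₁) (f₂ ≫ g₂) = coh f₁ f₂ ≫ coh g₁ g₂
  buh_id : ∀ X Y, buh (𝟙 X) (𝟙 Y) = 𝟙 (bu X Y)
  buh_comp : ∀ {X₁ Y₁ Z₁ X₂ Y₂ Z₂ : M} (f₁ : X₁ ⟶ Y₁) (g₁ : Y₁ ⟶ Z₁) (f₂ : X₂ ⟶ Y₂)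
    (g₂ : Y₂ ⟶ Z₂), buh (f₁ ≫ g₁) (f₂ ≫ g₂) = buh f₁ f₂ ≫ buh g₁ g₂
  coh_assoc : ∀ {X₁ Y₁ X₂ Y₂ X₃ Y₃ : M} (f₁ : X₁ ⟶ Y₁) (f₂ : X₂ ⟶ Y₂) (f₃ : X₃ ⟶ Y₃),
    coh (coh f₁ f₂) f₃
      = eqToHom (coA X₁ X₂ X₃) ≫ coh f₁ (coh f₂ f₃) ≫ eqToHom (coA Y₁ Y₂ Y₃).symm
  coh_unitL : ∀ {X Y : M} (f : X ⟶ Y),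
    coh (𝟙 uI) f = eqToHom (coL X) ≫ f ≫ eqToHom (coL Y).symm
  coh_unitR : ∀ {X Y : M} (f : X ⟶ Y),
    coh f (𝟙 uI) = eqToHom (coR X) ≫ f ≫ eqToHom (coR Y).symm
  buh_assoc : ∀ {X₁ Y₁ X₂ Y₂ X₃ Y₃ : M} (f₁ : X₁ ⟶ Y₁) (f₂ : X₂ ⟶ Y₂) (f₃ : X₃ ⟶ Y₃),
    buh (buh f₁ f₂) f₃
      = eqToHom (buA X₁ X₂ X₃) ≫ buh f₁ (buh f₂ f₃) ≫ eqToHom (buA Y₁ Y₂ Y₃).symm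
  buh_unitL : ∀ {X Y : M} (f : X ⟶ Y),
    buh (𝟙 uJ) f = eqToHom (buL X) ≫ f ≫ eqToHom (buL Y).symm
  buh_unitR : ∀ {X Y : M} (f : X ⟶ Y),
    buh f (𝟙 uJ) = eqToHom (buR X) ≫ f ≫ eqToHom (buR Y).symm
  dlI : uI ⟶ bu uI uI
  pw : co uJ uJ ⟶ uJ
  tau : uI ⟶ uJ
  zt : ∀ A B C D : M, co (bu A B) (bu C D) ⟶ bu (co A C) (co B D)
  zt_nat : ∀ {A A' B B' C C' D D' : M} (f : A ⟶ A') (g : B ⟶ B') (h : C ⟶ C')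
    (k : D ⟶ D'),
    coh (buh f g) (buh h k) ≫ zt A' B' C' D' = zt A B C D ≫ buh (coh f h) (coh g k)
  pw_assoc : coh pw (𝟙 uJ) ≫ pw = eqToHom (coA uJ uJ uJ) ≫ coh (𝟙 uJ) pw ≫ pw
  pw_unitL : eqToHom (coL uJ).symm ≫ coh tau (𝟙 uJ) ≫ pw = 𝟙 uJ
  pw_unitR : eqToHom (coR uJ).symm ≫ coh (𝟙 uJ) tau ≫ pw = 𝟙 uJ
  dlI_coassoc : dlI ≫ buh dlI (𝟙 uI) ≫ eqToHom (buA uI uI uI) = dlI ≫ buh (𝟙 uI) dlI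
  dlI_counitL : dlI ≫ buh tau (𝟙 uI) ≫ eqToHom (buL uI) = 𝟙 uI
  dlI_counitR : dlI ≫ buh (𝟙 uI) tau ≫ eqToHom (buR uI) = 𝟙 uI
  zt_assoc1 : ∀ A B C D E F : M,
    coh (zt A B C D) (𝟙 (bu E F)) ≫ zt (co A C) (co B D) E F
      = eqToHom (coA (bu A B) (bu C D) (bu E F)) ≫ coh (𝟙 (bu A B)) (zt C D E F)
          ≫ zt A B (co C E) (co D F)
          ≫ eqToHom (show bu (co A (co C E)) (co B (co D F))
              = bu (co (co A C) E) (co (co B D) F) by simp [coA])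
  zt_assoc2 : ∀ A B C D E F : M,
    zt (bu A B) C (bu D E) F ≫ buh (zt A B D E) (𝟙 (co C F))
      = eqToHom (show co (bu (bu A B) C) (bu (bu D E) F)
            = co (bu A (bu B C)) (bu D (bu E F)) by simp [buA])
          ≫ zt A (bu B C) D (bu E F) ≫ buh (𝟙 (co A D)) (zt B C E F)
          ≫ eqToHom (buA (co A D) (co B E) (co C F)).symm
  zt_unitA : ∀ A B : M,
    eqToHom (coL (bu A B)).symm ≫ coh dlI (𝟙 (bu A B)) ≫ zt uI uI A B
      ≫ eqToHom (show bu (co uI A) (co uI B) = bu A B by simp [coL]) = 𝟙 (bu A B)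
  zt_unitB : ∀ A B : M,
    eqToHom (coR (bu A B)).symm ≫ coh (𝟙 (bu A B)) dlI ≫ zt A B uI uI
      ≫ eqToHom (show bu (co A uI) (co B uI) = bu A B by simp [coR]) = 𝟙 (bu A B)
  zt_unitC : ∀ A B : M,
    eqToHom (show co A B = co (bu uJ A) (bu uJ B) by simp [buL]) ≫ zt uJ A uJ B
      ≫ buh pw (𝟙 (co A B)) ≫ eqToHom (buL (co A B)) = 𝟙 (co A B)
  zt_unitD : ∀ A B : M,
    eqToHom (show co A B = co (bu A uJ) (bu B uJ) by simp [buR]) ≫ zt A uJ B uJ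
      ≫ buh (𝟙 (co A B)) pw ≫ eqToHom (buR (co A B)) = 𝟙 (co A B)

namespace Duo

variable {M : Type u} [Category.{v} M] (D : Duo M)

/-- Axiom (WB): the multiplication is comultiplicative. -/
def WBeq (A : M) (mu : D.co A A ⟶ A) (dl : A ⟶ D.bu A A) : Prop :=
  mu ≫ dl = D.coh dl dl ≫ D.zt A A A A ≫ D.buh mu mu

/-- Axiom (RRU). -/
def RRUeq (A : M) (mu : D.co A A ⟶ A) (eta : D.uI ⟶ A) (dl : A ⟶ D.bu A A) : Prop :=
  D.dlI ≫ D.buh (𝟙 D.uI) (eta ≫ dl)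
    ≫ eqToHom (show D.bu D.uI (D.bu A A) = D.bu (D.co (D.bu D.uI A) D.uI) A by
        simp [D.coR, D.buA])
    ≫ D.buh (D.coh (𝟙 (D.bu D.uI A)) D.dlI) (𝟙 A)
    ≫ D.buh (D.coh (𝟙 (D.bu D.uI A)) (D.buh (𝟙 D.uI) (eta ≫ dl))) (𝟙 A)
    ≫ eqToHom (show D.bu (D.co (D.bu D.uI A) (D.bu D.uI (D.bu A A))) A
        = D.bu (D.co (D.bu D.uI A) (D.bu (D.bu D.uI A) A)) A by simp [D.buA])
    ≫ D.buh (D.zt D.uI A (D.bu D.uI A) A) (𝟙 A)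
    ≫ eqToHom (show D.bu (D.bu (D.co D.uI (D.bu D.uI A)) (D.co A A)) A
        = D.bu (D.bu (D.bu D.uI A) (D.co A A)) A by simp [D.coL])
    ≫ D.buh (D.buh (𝟙 (D.bu D.uI A)) mu) (𝟙 A)
  = D.dlI ≫ D.buh (𝟙 D.uI) eta ≫ D.buh (𝟙 D.uI) dl
    ≫ eqToHom (show D.bu D.uI (D.bu A A) = D.bu (D.bu D.uI A) A by simp [D.buA])
    ≫ D.buh (𝟙 (D.bu D.uI A)) dl
    ≫ eqToHom (show D.bu (D.bu D.uI A) (D.bu A A)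
        = D.bu (D.bu (D.bu D.uI A) A) A by simp [D.buA])

/-- Axiom (LRU). -/
def LRUeq (A : M) (mu : D.co A A ⟶ A) (eta : D.uI ⟶ A) (dl : A ⟶ D.bu A A) : Prop :=
  D.dlI ≫ D.buh (eta ≫ dl) (𝟙 D.uI)
    ≫ eqToHom (show D.bu (D.bu A A) D.uI = D.bu A (D.co (D.bu A D.uI) D.uI) by
        simp [D.coR, D.buA])
    ≫ D.buh (𝟙 A) (D.coh (𝟙 (D.bu A D.uI)) D.dlI)
    ≫ D.buh (𝟙 A) (D.coh (𝟙 (D.bu A D.uI)) (D.buh (eta ≫ dl) (𝟙 D.uI)))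
    ≫ eqToHom (show D.bu A (D.co (D.bu A D.uI) (D.bu (D.bu A A) D.uI))
        = D.bu A (D.co (D.bu A D.uI) (D.bu A (D.bu A D.uI))) by simp [D.buA])
    ≫ D.buh (𝟙 A) (D.zt A D.uI A (D.bu A D.uI))
    ≫ eqToHom (show D.bu A (D.bu (D.co A A) (D.co D.uI (D.bu A D.uI)))
        = D.bu (D.bu (D.bu A (D.co A A)) A) D.uI by simp [D.coL, D.buA])
    ≫ D.buh (D.buh (D.buh (𝟙 A) mu) (𝟙 A)) (𝟙 D.uI)
  = D.dlI ≫ D.buh eta (𝟙 D.uI) ≫ D.buh dl (𝟙 D.uI) ≫ D.buh (D.buh dl (𝟙 A)) (𝟙 D.uI)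

/-- Axiom (LRC). -/
def LRCeq (A : M) (mu : D.co A A ⟶ A) (dl : A ⟶ D.bu A A) (ep : A ⟶ D.uJ) : Prop :=
  D.coh (D.coh (𝟙 (D.co D.uJ A)) dl) (𝟙 A)
    ≫ eqToHom (show D.co (D.co (D.co D.uJ A) (D.bu A A)) A
        = D.co (D.co (D.bu (D.co D.uJ A) D.uJ) (D.bu A A)) A by simp [D.buR])
    ≫ D.coh (D.zt (D.co D.uJ A) D.uJ A A) (𝟙 A)
    ≫ D.coh (D.buh (eqToHom (D.coA D.uJ A A) ≫ D.coh (𝟙 D.uJ) (mu ≫ ep))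
        (𝟙 (D.co D.uJ A))) (𝟙 A)
    ≫ D.coh (D.buh D.pw (𝟙 (D.co D.uJ A))) (𝟙 A)
    ≫ eqToHom (show D.co (D.bu D.uJ (D.co D.uJ A)) A = D.co D.uJ (D.co A A) by
        simp [D.buL, D.coA])
    ≫ D.coh (𝟙 D.uJ) (mu ≫ ep) ≫ D.pw
  = eqToHom (show D.co (D.co (D.co D.uJ A) A) A = D.co (D.co D.uJ A) (D.co A A) by
        simp [D.coA])
    ≫ D.coh (𝟙 (D.co D.uJ A)) mu
    ≫ eqToHom (D.coA D.uJ A A)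
    ≫ D.coh (𝟙 D.uJ) mu ≫ D.coh (𝟙 D.uJ) ep ≫ D.pw

/-- Axiom (LLC). -/
def LLCeq (A : M) (mu : D.co A A ⟶ A) (dl : A ⟶ D.bu A A) (ep : A ⟶ D.uJ) : Prop :=
  D.coh (D.coh (𝟙 (D.co D.uJ A)) dl) (𝟙 A)
    ≫ eqToHom (show D.co (D.co (D.co D.uJ A) (D.bu A A)) A
        = D.co (D.co (D.bu D.uJ (D.co D.uJ A)) (D.bu A A)) A by simp [D.buL])
    ≫ D.coh (D.zt D.uJ (D.co D.uJ A) A A) (𝟙 A)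
    ≫ D.coh (D.buh (𝟙 (D.co D.uJ A))
        (eqToHom (D.coA D.uJ A A) ≫ D.coh (𝟙 D.uJ) (mu ≫ ep))) (𝟙 A)
    ≫ D.coh (D.buh (𝟙 (D.co D.uJ A)) D.pw) (𝟙 A)
    ≫ eqToHom (show D.co (D.bu (D.co D.uJ A) D.uJ) A = D.co D.uJ (D.co A A) by
        simp [D.buR, D.coA])
    ≫ D.coh (𝟙 D.uJ) (mu ≫ ep) ≫ D.pw
  = eqToHom (show D.co (D.co (D.co D.uJ A) A) A = D.co (D.co D.uJ A) (D.co A A) by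
        simp [D.coA])
    ≫ D.coh (𝟙 (D.co D.uJ A)) mu
    ≫ eqToHom (D.coA D.uJ A A)
    ≫ D.coh (𝟙 D.uJ) mu ≫ D.coh (𝟙 D.uJ) ep ≫ D.pw

/-- Axiom (RLU), obtained from (RRU) by replacing `∘` by its opposite. -/
def RLUeq (A : M) (mu : D.co A A ⟶ A) (eta : D.uI ⟶ A) (dl : A ⟶ D.bu A A) : Prop :=
  D.dlI ≫ D.buh (𝟙 D.uI) (eta ≫ dl)
    ≫ eqToHom (show D.bu D.uI (D.bu A A) = D.bu (D.co D.uI (D.bu D.uI A)) A by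
        simp [D.coL, D.buA])
    ≫ D.buh (D.coh D.dlI (𝟙 (D.bu D.uI A))) (𝟙 A)
    ≫ D.buh (D.coh (D.buh (𝟙 D.uI) (eta ≫ dl)) (𝟙 (D.bu D.uI A))) (𝟙 A)
    ≫ eqToHom (show D.bu (D.co (D.bu D.uI (D.bu A A)) (D.bu D.uI A)) A
        = D.bu (D.co (D.bu (D.bu D.uI A) A) (D.bu D.uI A)) A by simp [D.buA])
    ≫ D.buh (D.zt (D.bu D.uI A) A D.uI A) (𝟙 A)
    ≫ eqToHom (show D.bu (D.bu (D.co (D.bu D.uI A) D.uI) (D.co A A)) A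
        = D.bu (D.bu (D.bu D.uI A) (D.co A A)) A by simp [D.coR])
    ≫ D.buh (D.buh (𝟙 (D.bu D.uI A)) mu) (𝟙 A)
  = D.dlI ≫ D.buh (𝟙 D.uI) eta ≫ D.buh (𝟙 D.uI) dl
    ≫ eqToHom (show D.bu D.uI (D.bu A A) = D.bu (D.bu D.uI A) A by simp [D.buA])
    ≫ D.buh (𝟙 (D.bu D.uI A)) dl
    ≫ eqToHom (show D.bu (D.bu D.uI A) (D.bu A A)
        = D.bu (D.bu (D.bu D.uI A) A) A by simp [D.buA])

/-- Axiom (LLU), obtained from (LRU) by replacing `∘` by its opposite. -/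
def LLUeq (A : M) (mu : D.co A A ⟶ A) (eta : D.uI ⟶ A) (dl : A ⟶ D.bu A A) : Prop :=
  D.dlI ≫ D.buh (eta ≫ dl) (𝟙 D.uI)
    ≫ eqToHom (show D.bu (D.bu A A) D.uI = D.bu A (D.co D.uI (D.bu A D.uI)) by
        simp [D.coL, D.buA])
    ≫ D.buh (𝟙 A) (D.coh D.dlI (𝟙 (D.bu A D.uI)))
    ≫ D.buh (𝟙 A) (D.coh (D.buh (eta ≫ dl) (𝟙 D.uI)) (𝟙 (D.bu A D.uI)))
    ≫ eqToHom (show D.bu A (D.co (D.bu (D.bu A A) D.uI) (D.bu A D.uI))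
        = D.bu A (D.co (D.bu A (D.bu A D.uI)) (D.bu A D.uI)) by simp [D.buA])
    ≫ D.buh (𝟙 A) (D.zt A (D.bu A D.uI) A D.uI)
    ≫ eqToHom (show D.bu A (D.bu (D.co A A) (D.co (D.bu A D.uI) D.uI))
        = D.bu (D.bu (D.bu A (D.co A A)) A) D.uI by simp [D.coR, D.buA])
    ≫ D.buh (D.buh (D.buh (𝟙 A) mu) (𝟙 A)) (𝟙 D.uI)
  = D.dlI ≫ D.buh eta (𝟙 D.uI) ≫ D.buh dl (𝟙 D.uI) ≫ D.buh (D.buh dl (𝟙 A)) (𝟙 D.uI)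

/-- Axiom (RRC), obtained from (LLC) by replacing `∘` by its opposite. -/
def RRCeq (A : M) (mu : D.co A A ⟶ A) (dl : A ⟶ D.bu A A) (ep : A ⟶ D.uJ) : Prop :=
  D.coh (D.coh (D.coh (𝟙 A) dl) (𝟙 A)) (𝟙 D.uJ)
    ≫ eqToHom (show D.co (D.co (D.co A (D.bu A A)) A) D.uJ
        = D.co A (D.co (D.bu A A) (D.bu (D.co A D.uJ) D.uJ)) by simp [D.coA, D.buR])
    ≫ D.coh (𝟙 A) (D.zt A A (D.co A D.uJ) D.uJ)
    ≫ D.coh (𝟙 A) (D.buh (eqToHom (D.coA A A D.uJ).symm ≫ D.coh (mu ≫ ep) (𝟙 D.uJ))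
        (𝟙 (D.co A D.uJ)))
    ≫ D.coh (𝟙 A) (D.buh D.pw (𝟙 (D.co A D.uJ)))
    ≫ eqToHom (show D.co A (D.bu D.uJ (D.co A D.uJ)) = D.co (D.co A A) D.uJ by
        simp [D.buL, D.coA])
    ≫ D.coh (mu ≫ ep) (𝟙 D.uJ) ≫ D.pw
  = D.coh (D.coh mu (𝟙 A)) (𝟙 D.uJ) ≫ D.coh mu (𝟙 D.uJ) ≫ D.coh ep (𝟙 D.uJ) ≫ D.pw

/-- Axiom (RLC), obtained from (LRC) by replacing `∘` by its opposite. -/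
def RLCeq (A : M) (mu : D.co A A ⟶ A) (dl : A ⟶ D.bu A A) (ep : A ⟶ D.uJ) : Prop :=
  D.coh (D.coh (D.coh (𝟙 A) dl) (𝟙 A)) (𝟙 D.uJ)
    ≫ eqToHom (show D.co (D.co (D.co A (D.bu A A)) A) D.uJ
        = D.co A (D.co (D.bu A A) (D.bu D.uJ (D.co A D.uJ))) by simp [D.coA, D.buL])
    ≫ D.coh (𝟙 A) (D.zt A A D.uJ (D.co A D.uJ))
    ≫ D.coh (𝟙 A) (D.buh (𝟙 (D.co A D.uJ))
        (eqToHom (D.coA A A D.uJ).symm ≫ D.coh (mu ≫ ep) (𝟙 D.uJ)))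
    ≫ D.coh (𝟙 A) (D.buh (𝟙 (D.co A D.uJ)) D.pw)
    ≫ eqToHom (show D.co A (D.bu (D.co A D.uJ) D.uJ) = D.co (D.co A A) D.uJ by
        simp [D.buR, D.coA])
    ≫ D.coh (mu ≫ ep) (𝟙 D.uJ) ≫ D.pw
  = D.coh (D.coh mu (𝟙 A)) (𝟙 D.uJ) ≫ D.coh mu (𝟙 D.uJ) ≫ D.coh ep (𝟙 D.uJ) ≫ D.pw

end Duo

/-- A right weak bimonoid in a duoidal category. -/
structure RWB {M : Type u} [Category.{v} M] (D : Duo M) where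
  A : M
  mu : D.co A A ⟶ A
  eta : D.uI ⟶ A
  dl : A ⟶ D.bu A A
  ep : A ⟶ D.uJ
  mu_assoc : D.coh mu (𝟙 A) ≫ mu = eqToHom (D.coA A A A) ≫ D.coh (𝟙 A) mu ≫ mu
  mu_unitL : eqToHom (D.coL A).symm ≫ D.coh eta (𝟙 A) ≫ mu = 𝟙 A
  mu_unitR : eqToHom (D.coR A).symm ≫ D.coh (𝟙 A) eta ≫ mu = 𝟙 A
  dl_coassoc : dl ≫ D.buh dl (𝟙 A) ≫ eqToHom (D.buA A A A) = dl ≫ D.buh (𝟙 A) dl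
  dl_counitL : dl ≫ D.buh ep (𝟙 A) ≫ eqToHom (D.buL A) = 𝟙 A
  dl_counitR : dl ≫ D.buh (𝟙 A) ep ≫ eqToHom (D.buR A) = 𝟙 A
  wb : D.WBeq A mu dl
  rru : D.RRUeq A mu eta dl
  lru : D.LRUeq A mu eta dl
  lrc : D.LRCeq A mu dl ep
  llc : D.LLCeq A mu dl ep

/-- A weak bimonoid: both a right weak bimonoid and a left weak bimonoid. -/
structure WBim {M : Type u} [Category.{v} M] (D : Duo M) extends RWB D where
  rlu : D.RLUeq A mu eta dl
  llu : D.LLUeq A mu eta dl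
  rlc : D.RLCeq A mu dl ep
  rrc : D.RRCeq A mu dl ep

/-- Idempotent morphisms split in `M`. -/
def SplitIdem (M : Type u) [Category.{v} M] : Prop :=
  ∀ ⦃X : M⦄ (e : X ⟶ X), e ≫ e = e →
    ∃ (Y : M) (p : X ⟶ Y) (i : Y ⟶ X), p ≫ i = e ∧ i ≫ p = 𝟙 Y

namespace RWB

variable {M : Type u} [Category.{v} M] {D : Duo M} (W : RWB D)

/-- The object `J∘A`. -/
def JA : M := D.co D.uJ W.A

/-- The idempotent morphism `⊓^R_∘ :=
((J∘A)•ϖ).((J∘A)•(J∘(ε.μ))).ζ.(J∘A∘(Δ.η)) : J∘A ⟶ J∘A`. -/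
def sqcapR : W.JA ⟶ W.JA :=
  eqToHom (show W.JA = D.co W.JA D.uI by simp [D.coR])
    ≫ D.coh (𝟙 W.JA) (W.eta ≫ W.dl)
    ≫ eqToHom (show D.co W.JA (D.bu W.A W.A)
        = D.co (D.bu D.uJ W.JA) (D.bu W.A W.A) by simp [D.buL])
    ≫ D.zt D.uJ W.JA W.A W.A
    ≫ D.buh (𝟙 W.JA) (eqToHom (D.coA D.uJ W.A W.A) ≫ D.coh (𝟙 D.uJ) (W.mu ≫ W.ep))
    ≫ D.buh (𝟙 W.JA) D.pw
    ≫ eqToHom (D.buR W.JA)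

/-- The natural idempotent `χ^R_{F,G} = (φ•γ).ζ.((F•G)∘(Δ.η))` on `F•G`, for right
`A`-modules `(F,f)` and `(G,g)`. -/
def chiR (F G : M) (f : D.co F W.A ⟶ F) (g : D.co G W.A ⟶ G) :
    D.bu F G ⟶ D.bu F G :=
  eqToHom (show D.bu F G = D.co (D.bu F G) D.uI by simp [D.coR])
    ≫ D.coh (𝟙 (D.bu F G)) (W.eta ≫ W.dl)
    ≫ D.zt F G W.A W.A
    ≫ D.buh f g

/-- The morphism `J∘η : J ⟶ J∘A`. -/
def jeta : D.uJ ⟶ W.JA :=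
  eqToHom (D.coR D.uJ).symm ≫ D.coh (𝟙 D.uJ) W.eta

/-- The morphism `(π^R_∘).(τ∘A) : A ⟶ R_∘` needs `τ∘A : A ⟶ J∘A`. -/
def tauA : W.A ⟶ W.JA :=
  eqToHom (D.coL W.A).symm ≫ D.coh D.tau (𝟙 W.A)

section Retract

variable (R : M) (p : W.JA ⟶ R) (i : R ⟶ W.JA)

/-- The right `A`-action `γ_A = π^R_∘.(J∘μ).(ι^R_∘ ∘ A)` on the retract `R_∘`. -/
def gamA : D.co R W.A ⟶ R :=
  D.coh i (𝟙 W.A) ≫ eqToHom (D.coA D.uJ W.A W.A) ≫ D.coh (𝟙 D.uJ) W.mu ≫ p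

/-- The left `J`-action `γ_J = π^R_∘.(ϖ∘A).(J∘ι^R_∘)` on the retract `R_∘`. -/
def gamJ : D.co D.uJ R ⟶ R :=
  D.coh (𝟙 D.uJ) i ≫ eqToHom (D.coA D.uJ D.uJ W.A).symm ≫ D.coh D.pw (𝟙 W.A) ≫ p

/-- The multiplication `μ^R_∘ = (R∘•ϖ).(R∘•(J∘ε)).(R∘•ι^R_∘).χ^R_{R∘,R∘}`. -/
def muR : D.bu R R ⟶ R :=
  W.chiR R R (W.gamA R p i) (W.gamA R p i)
    ≫ D.buh (𝟙 R) i
    ≫ D.buh (𝟙 R) (D.coh (𝟙 D.uJ) W.ep)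
    ≫ D.buh (𝟙 R) D.pw
    ≫ eqToHom (D.buR R)

/-- The unit `η^R_∘ = π^R_∘.(J∘η)`. -/
def etaR : D.uJ ⟶ R := W.jeta ≫ p

/-- The comultiplication `Δ^R_∘ = χ^R_{R∘,R∘}.(R∘•π^R_∘).(R∘•(J∘η))`. -/
def DeltaR : R ⟶ D.bu R R :=
  eqToHom (D.buR R).symm
    ≫ D.buh (𝟙 R) W.jeta
    ≫ D.buh (𝟙 R) p
    ≫ W.chiR R R (W.gamA R p i) (W.gamA R p i)

/-- The counit `ε^R_∘ = ϖ.(J∘ε).ι^R_∘`. -/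
def epsR : R ⟶ D.uJ := i ≫ D.coh (𝟙 D.uJ) W.ep ≫ D.pw

end Retract

/-- The comultiplication-type morphism `ζ.(J∘Δ) : J∘A ⟶ (J∘A)•(J∘A)`. -/
def coact0 : W.JA ⟶ D.bu W.JA W.JA :=
  D.coh (𝟙 D.uJ) W.dl
    ≫ eqToHom (show D.co D.uJ (D.bu W.A W.A)
        = D.co (D.bu D.uJ D.uJ) (D.bu W.A W.A) by simp [D.buL])
    ≫ D.zt D.uJ D.uJ W.A W.A

end RWB

/-- Morphisms of `M` with source and target forgotten, together with a zero that serves as the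
composite of non-composable morphisms.  Equalities of objects become invisible here, so that the
strict monoidal structures are associative and unital on the nose. -/
inductive Arr (M : Type u) [Category.{v} M] : Type (max u v)
  | zero : Arr M
  | up {X Y : M} (f : X ⟶ Y) : Arr M

namespace Arr

variable {M : Type u} [Category.{v} M]

/-- The identity morphism as an element of `Arr M`. -/
def one (X : M) : Arr M := up (𝟙 X)

/-- The source, if it exists. -/
def dom : Arr M → Option M
  | zero => none
  | up (X := X) _ => some X

/-- The target, if it exists. -/
def cod : Arr M → Option M
  | zero => none
  | up (Y := Y) _ => some Y

open Classical in
/-- Composition in diagrammatic order. -/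
noncomputable def comp : Arr M → Arr M → Arr M
  | up (Y := Y) f, up (X := Y') g => if h : Y = Y' then up (f ≫ eqToHom h ≫ g) else zero
  | _, _ => zero

noncomputable instance : Mul (Arr M) := ⟨comp⟩

@[simp] lemma dom_up {X Y : M} (f : X ⟶ Y) : dom (up f) = some X := (rfl)
@[simp] lemma cod_up {X Y : M} (f : X ⟶ Y) : cod (up f) = some Y := (rfl)
@[simp] lemma dom_one (X : M) : dom (one X) = some X := (rfl)
@[simp] lemma cod_one (X : M) : cod (one X) = some X := (rfl)

protected lemma zero_mul (a : Arr M) : zero * a = zero := rfl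

protected lemma mul_zero (a : Arr M) : a * zero = zero := by
  cases a <;> rfl

lemma up_mul_up {X Y Z : M} (f : X ⟶ Y) (g : Y ⟶ Z) : up f * up g = up (f ≫ g) := by
  change comp _ _ = _
  simp [comp]

lemma up_mul_up_of_ne {X Y Y' Z : M} (h : Y ≠ Y') (f : X ⟶ Y) (g : Y' ⟶ Z) :
    up f * up g = zero := by
  change comp _ _ = _
  simp [comp, h]

noncomputable instance : Semigroup (Arr M) where
  mul_assoc a b c := by
    obtain _ | @⟨X, Y, f⟩ := a
    · rfl
    obtain _ | @⟨Y', Z, g⟩ := b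
    · rfl
    obtain _ | @⟨Z', V, h⟩ := c
    · simp only [Arr.mul_zero]
    by_cases h₁ : Y = Y'
    · subst h₁
      by_cases h₂ : Z = Z'
      · subst h₂
        simp only [up_mul_up, Category.assoc]
      · rw [up_mul_up, up_mul_up_of_ne h₂, up_mul_up_of_ne h₂, Arr.mul_zero]
    · rw [up_mul_up_of_ne h₁]
      by_cases h₂ : Z = Z'
      · subst h₂
        rw [up_mul_up, up_mul_up_of_ne h₁, Arr.zero_mul]
      · rw [up_mul_up_of_ne h₂, Arr.zero_mul, Arr.mul_zero]

lemma up_injective {X Y : M} {f g : X ⟶ Y} (h : up f = up g) : f = g := by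
  simpa using h

lemma up_comp {X Y Z : M} (f : X ⟶ Y) (g : Y ⟶ Z) : up (f ≫ g) = up f * up g :=
  (up_mul_up f g).symm

lemma up_id (X : M) : up (𝟙 X) = one X := rfl

lemma up_eqToHom {X Y : M} (h : X = Y) : up (eqToHom h) = one X := by
  subst h; rfl

lemma exists_up {a : Arr M} {X Y : M} (hX : dom a = some X) (hY : cod a = some Y) :
    ∃ f : X ⟶ Y, up f = a := by
  obtain _ | @⟨X', Y', f⟩ := a
  · cases hX
  · obtain rfl : X' = X := by simpa using hX
    obtain rfl : Y' = Y := by simpa using hY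
    exact ⟨f, rfl⟩

/-- Two composable elements are both zero or both morphisms. -/
lemma composable_cases {a b : Arr M} (h : cod a = dom b) : (a = zero ∧ b = zero) ∨
    ∃ (X Y Z : M) (f : X ⟶ Y) (g : Y ⟶ Z), a = up f ∧ b = up g := by
  obtain _ | @⟨X, Y, f⟩ := a <;> obtain _ | @⟨Y', Z, g⟩ := b
  · exact .inl ⟨rfl, rfl⟩
  · cases h
  · cases h
  · obtain rfl : Y = Y' := by simpa using h
    exact .inr ⟨X, Y, Z, f, g, rfl, rfl⟩

@[simp] lemma dom_mul {a b : Arr M} (h : cod a = dom b) : dom (a * b) = dom a := by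
  obtain ⟨rfl, rfl⟩ | ⟨X, Y, Z, f, g, rfl, rfl⟩ := composable_cases h
  · rfl
  · rw [up_mul_up]; rfl

@[simp] lemma cod_mul {a b : Arr M} (h : cod a = dom b) : cod (a * b) = cod b := by
  obtain ⟨rfl, rfl⟩ | ⟨X, Y, Z, f, g, rfl, rfl⟩ := composable_cases h
  · rfl
  · rw [up_mul_up]; rfl

lemma one_mul_of_dom {a : Arr M} {X : M} (h : dom a = some X) : one X * a = a := by
  obtain _ | @⟨X', Y, f⟩ := a
  · cases h
  · obtain rfl : X' = X := by simpa using h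
    rw [one, up_mul_up, Category.id_comp]

lemma mul_one_of_cod {a : Arr M} {X : M} (h : cod a = some X) : a * one X = a := by
  obtain _ | @⟨Y, X', f⟩ := a
  · cases h
  · obtain rfl : X' = X := by simpa using h
    rw [one, up_mul_up, Category.comp_id]

lemma one_mul_mul_of_dom {a b : Arr M} {X : M} (h : dom a = some X) :
    one X * (a * b) = a * b := by
  rw [← mul_assoc, one_mul_of_dom h]

end Arr

namespace Duo

open Arr

variable {M : Type u} [Category.{v} M] (D : Duo M)

/-- The product `∘` on `Arr M`. -/
def aco : Arr M → Arr M → Arr M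
  | up f, up g => up (D.coh f g)
  | _, _ => zero

/-- The product `•` on `Arr M`. -/
def abu : Arr M → Arr M → Arr M
  | up f, up g => up (D.buh f g)
  | _, _ => zero

attribute [simp] coA coL coR buA buL buR

local infixr:75 " ⊙ " => D.aco
local infixr:75 " ⊡ " => D.abu

lemma aco_zero (a : Arr M) : a ⊙ zero = zero := by
  cases a <;> rfl

lemma abu_zero (a : Arr M) : a ⊡ zero = zero := by
  cases a <;> rfl

lemma up_coh {X Y X' Y' : M} (f : X ⟶ Y) (g : X' ⟶ Y') : up (D.coh f g) = up f ⊙ up g := rfl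

lemma up_buh {X Y X' Y' : M} (f : X ⟶ Y) (g : X' ⟶ Y') : up (D.buh f g) = up f ⊡ up g := rfl

lemma one_co (X Y : M) : one (D.co X Y) = one X ⊙ one Y := by
  rw [one, ← D.coh_id]; rfl

lemma one_bu (X Y : M) : one (D.bu X Y) = one X ⊡ one Y := by
  rw [one, ← D.buh_id]; rfl

@[simp] lemma dom_aco (a b : Arr M) : dom (a ⊙ b) = Option.map₂ D.co (dom a) (dom b) := by
  cases a <;> cases b <;> rfl

@[simp] lemma cod_aco (a b : Arr M) : cod (a ⊙ b) = Option.map₂ D.co (cod a) (cod b) := by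
  cases a <;> cases b <;> rfl

@[simp] lemma dom_abu (a b : Arr M) : dom (a ⊡ b) = Option.map₂ D.bu (dom a) (dom b) := by
  cases a <;> cases b <;> rfl

@[simp] lemma cod_abu (a b : Arr M) : cod (a ⊡ b) = Option.map₂ D.bu (cod a) (cod b) := by
  cases a <;> cases b <;> rfl

lemma aco_mul_aco {a b c d : Arr M} (h₁ : cod a = dom b) (h₂ : cod c = dom d) :
    (a ⊙ c) * (b ⊙ d) = (a * b) ⊙ (c * d) := by
  obtain ⟨rfl, rfl⟩ | ⟨X, Y, Z, f, g, rfl, rfl⟩ := composable_cases h₁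
  · rfl
  obtain ⟨rfl, rfl⟩ | ⟨X', Y', Z', f', g', rfl, rfl⟩ := composable_cases h₂
  · rw [aco_zero, aco_zero, Arr.zero_mul, aco_zero]
  simp only [up_mul_up, ← up_coh, D.coh_comp]

lemma abu_mul_abu {a b c d : Arr M} (h₁ : cod a = dom b) (h₂ : cod c = dom d) :
    (a ⊡ c) * (b ⊡ d) = (a * b) ⊡ (c * d) := by
  obtain ⟨rfl, rfl⟩ | ⟨X, Y, Z, f, g, rfl, rfl⟩ := composable_cases h₁
  · rfl
  obtain ⟨rfl, rfl⟩ | ⟨X', Y', Z', f', g', rfl, rfl⟩ := composable_cases h₂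
  · rw [abu_zero, abu_zero, Arr.zero_mul, abu_zero]
  simp only [up_mul_up, ← up_buh, D.buh_comp]

lemma aco_assoc (a b c : Arr M) : (a ⊙ b) ⊙ c = a ⊙ b ⊙ c := by
  obtain _ | f := a
  · rfl
  obtain _ | g := b
  · rfl
  obtain _ | h := c
  · simp only [aco_zero]
  simp only [← up_coh]
  rw [D.coh_assoc]
  simp only [up_comp, up_eqToHom]
  rw [one_mul_mul_of_dom (by simp), mul_one_of_cod (by simp)]

lemma abu_assoc (a b c : Arr M) : (a ⊡ b) ⊡ c = a ⊡ b ⊡ c := by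
  obtain _ | f := a
  · rfl
  obtain _ | g := b
  · rfl
  obtain _ | h := c
  · simp only [abu_zero]
  simp only [← up_buh]
  rw [D.buh_assoc]
  simp only [up_comp, up_eqToHom]
  rw [one_mul_mul_of_dom (by simp), mul_one_of_cod (by simp)]

lemma one_aco (a : Arr M) : one D.uI ⊙ a = a := by
  obtain _ | f := a
  · rfl
  rw [one, ← up_coh, D.coh_unitL]
  simp only [up_comp, up_eqToHom]
  rw [one_mul_mul_of_dom (by simp), mul_one_of_cod (by simp)]

lemma aco_one (a : Arr M) : a ⊙ one D.uI = a := by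
  obtain _ | f := a
  · rfl
  rw [one, ← up_coh, D.coh_unitR]
  simp only [up_comp, up_eqToHom]
  rw [one_mul_mul_of_dom (by simp), mul_one_of_cod (by simp)]

lemma one_abu (a : Arr M) : one D.uJ ⊡ a = a := by
  obtain _ | f := a
  · rfl
  rw [one, ← up_buh, D.buh_unitL]
  simp only [up_comp, up_eqToHom]
  rw [one_mul_mul_of_dom (by simp), mul_one_of_cod (by simp)]

lemma abu_one (a : Arr M) : a ⊡ one D.uJ = a := by
  obtain _ | f := a
  · rfl
  rw [one, ← up_buh, D.buh_unitR]
  simp only [up_comp, up_eqToHom]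
  rw [one_mul_mul_of_dom (by simp), mul_one_of_cod (by simp)]

/-- The interchange morphism as an element of `Arr M`. -/
def azt (A B C E : M) : Arr M := up (D.zt A B C E)

@[simp] lemma dom_azt (A B C E : M) :
    dom (D.azt A B C E) = some (D.co (D.bu A B) (D.bu C E)) := (rfl)

@[simp] lemma cod_azt (A B C E : M) :
    cod (D.azt A B C E) = some (D.bu (D.co A C) (D.co B E)) := (rfl)

lemma azt_nat {A A' B B' C C' E E' : M} {f g h k : Arr M}
    (hA : dom f = some A) (hA' : cod f = some A') (hB : dom g = some B) (hB' : cod g = some B')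
    (hC : dom h = some C) (hC' : cod h = some C') (hE : dom k = some E) (hE' : cod k = some E') :
    ((f ⊡ g) ⊙ (h ⊡ k)) * D.azt A' B' C' E' = D.azt A B C E * ((f ⊙ h) ⊡ (g ⊙ k)) := by
  obtain ⟨f, rfl⟩ := exists_up hA hA'
  obtain ⟨g, rfl⟩ := exists_up hB hB'
  obtain ⟨h, rfl⟩ := exists_up hC hC'
  obtain ⟨k, rfl⟩ := exists_up hE hE'
  simp only [← up_coh, ← up_buh, azt, up_mul_up, D.zt_nat]

lemma azt_assoc_co (A B C E F G : M) :
    (D.azt A B C E ⊙ one (D.bu F G)) * D.azt (D.co A C) (D.co B E) F G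
      = (one (D.bu A B) ⊙ D.azt C E F G) * D.azt A B (D.co C F) (D.co E G) := by
  have h := congrArg up (D.zt_assoc1 A B C E F G)
  simp only [up_comp, up_eqToHom, up_coh, up_id] at h
  rw [one_mul_mul_of_dom (by simp), mul_one_of_cod (by simp)] at h
  exact h

lemma azt_assoc_bu (A B C E F G : M) :
    D.azt (D.bu A B) C (D.bu E F) G * (D.azt A B E F ⊡ one (D.co C G))
      = D.azt A (D.bu B C) E (D.bu F G) * (one (D.co A E) ⊡ D.azt B C F G) := by
  have h := congrArg up (D.zt_assoc2 A B C E F G)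
  simp only [up_comp, up_eqToHom, up_buh, up_id] at h
  rw [one_mul_mul_of_dom (by simp), mul_one_of_cod (by simp)] at h
  exact h

lemma aco_dlI_mul_azt (A B : M) :
    (one (D.bu A B) ⊙ up D.dlI) * D.azt A B D.uI D.uI = one (D.bu A B) := by
  have h := congrArg up (D.zt_unitB A B)
  simp only [up_comp, up_eqToHom, up_coh, up_id] at h
  rw [one_mul_mul_of_dom (by simp), mul_one_of_cod (by simp)] at h
  exact h

lemma azt_mul_pw_abu (A B : M) :
    D.azt D.uJ A D.uJ B * (up D.pw ⊡ one (D.co A B)) = one (D.co A B) := by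
  have h := congrArg up (D.zt_unitC A B)
  simp only [up_comp, up_eqToHom, up_buh, up_id] at h
  rw [one_mul_mul_of_dom (by simp), mul_one_of_cod (by simp)] at h
  exact h

lemma one_aco_mul_aco_one {a b : Arr M} {X Y : M} (ha : dom a = some X) (hb : cod b = some Y) :
    (one X ⊙ b) * (a ⊙ one Y) = a ⊙ b := by
  rw [aco_mul_aco _ (by simp [ha]) (by simp [hb]), one_mul_of_dom ha, mul_one_of_cod hb]

lemma aco_one_mul_one_aco {a b : Arr M} {X Y : M} (ha : cod a = some X) (hb : dom b = some Y) :
    (a ⊙ one Y) * (one X ⊙ b) = a ⊙ b := by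
  rw [aco_mul_aco _ (by simp [ha]) (by simp [hb]), one_mul_of_dom hb, mul_one_of_cod ha]

lemma one_abu_mul_abu_one {a b : Arr M} {X Y : M} (ha : dom a = some X) (hb : cod b = some Y) :
    (one X ⊡ b) * (a ⊡ one Y) = a ⊡ b := by
  rw [abu_mul_abu _ (by simp [ha]) (by simp [hb]), one_mul_of_dom ha, mul_one_of_cod hb]

lemma abu_one_mul_one_abu {a b : Arr M} {X Y : M} (ha : cod a = some X) (hb : dom b = some Y) :
    (a ⊡ one Y) * (one X ⊡ b) = a ⊡ b := by
  rw [abu_mul_abu _ (by simp [ha]) (by simp [hb]), one_mul_of_dom hb, mul_one_of_cod ha]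

lemma mul_one_aco {a b : Arr M} {X : M} (ha : cod a = some X) (hb : dom b = some D.uI) :
    a * (one X ⊙ b) = a ⊙ b := by
  conv_lhs => rw [← D.aco_one a]
  rw [aco_one_mul_one_aco _ ha hb]

lemma one_mul_one (X : M) : one X * one X = one X := one_mul_of_dom rfl

lemma one_aco_mul (X : M) {b c : Arr M} (h : cod b = dom c) :
    one X ⊙ (b * c) = (one X ⊙ b) * (one X ⊙ c) := by
  rw [aco_mul_aco _ rfl h, one_mul_one]

lemma mul_aco_one (X : M) {b c : Arr M} (h : cod b = dom c) :
    (b * c) ⊙ one X = (b ⊙ one X) * (c ⊙ one X) := by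
  rw [aco_mul_aco _ h rfl, one_mul_one]

lemma one_abu_mul (X : M) {b c : Arr M} (h : cod b = dom c) :
    one X ⊡ (b * c) = (one X ⊡ b) * (one X ⊡ c) := by
  rw [abu_mul_abu _ rfl h, one_mul_one]

lemma mul_abu_one (X : M) {b c : Arr M} (h : cod b = dom c) :
    (b * c) ⊡ one X = (b ⊡ one X) * (c ⊡ one X) := by
  rw [abu_mul_abu _ h rfl, one_mul_one]

lemma one_abu_mul_eq {a b : Arr M} {X : M} (ha : dom a = some X) (hb : cod b = some D.uJ) :
    (one X ⊡ b) * a = a ⊡ b := by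
  conv_lhs => rw [← D.abu_one a]
  rw [one_abu_mul_abu_one _ ha hb]

lemma abu_one_mul_eq {a b : Arr M} {X : M} (ha : cod a = some D.uJ) (hb : dom b = some X) :
    (a ⊡ one X) * b = a ⊡ b := by
  conv_lhs => rw [← D.one_abu b]
  rw [abu_one_mul_one_abu _ ha hb]

lemma mul_one_abu_eq {a b : Arr M} {X : M} (ha : cod a = some X) (hb : dom b = some D.uJ) :
    a * (one X ⊡ b) = a ⊡ b := by
  conv_lhs => rw [← D.abu_one a]
  rw [abu_one_mul_one_abu _ ha hb]

/-- Naturality of the interchange in its two right hand arguments, after whiskering. -/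
lemma one_aco_mul_azt_mul {w x y : Arr M} {X Y P P' Q Q' : M}
    (hw : cod w = some (D.bu P Q)) (hx : dom x = some P) (hx' : cod x = some P')
    (hy : dom y = some Q) (hy' : cod y = some Q') :
    (one (D.bu X Y) ⊙ w) * (D.azt X Y P Q * ((one X ⊙ x) ⊡ (one Y ⊙ y)))
      = (one (D.bu X Y) ⊙ (w * (x ⊡ y))) * D.azt X Y P' Q' := by
  rw [← D.azt_nat (f := one X) (g := one Y) rfl rfl rfl rfl hx hx' hy hy', ← one_bu,
    one_aco_mul _ _ (by simp [hw, hx, hy]), mul_assoc]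

lemma dlI_mul_one_abu_mul {w : Arr M} {P : M} (hw : dom w = some D.uI) (hw' : cod w = some P) :
    up D.dlI * ((one D.uI ⊡ w) * (up D.tau ⊡ one P)) = w := by
  have h := congrArg up D.dlI_counitL
  simp only [up_comp, up_eqToHom, D.up_buh, up_id] at h
  rw [mul_one_of_cod (by simp)] at h
  rw [one_abu_mul_abu_one _ rfl hw', ← abu_one_mul_one_abu _ rfl hw, ← mul_assoc, h, one_abu,
    one_mul_of_dom hw]

end Duo

namespace RWB

open Arr

variable {M : Type u} [Category.{v} M] {D : Duo M} (W : RWB D)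

local infixr:75 " ⊙ " => D.aco
local infixr:75 " ⊡ " => D.abu

/-- The composite `Δ.η`. -/
def dlEta : Arr M := up (W.eta ≫ W.dl)

@[simp] lemma dom_dlEta : dom W.dlEta = some D.uI := (rfl)
@[simp] lemma cod_dlEta : cod W.dlEta = some (D.bu W.A W.A) := (rfl)

/-- The morphism `ζ.((X•Y)∘(Δ.η)) : X•Y ⟶ (X∘A)•(Y∘A)`. -/
noncomputable def chi (X Y : M) : Arr M := (one (D.bu X Y) ⊙ W.dlEta) * D.azt X Y W.A W.A

/-- The morphism `ζ.((X•Y)∘Δ) : (X•Y)∘A ⟶ (X∘A)•(Y∘A)`. -/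
noncomputable def psi (X Y : M) : Arr M := (one (D.bu X Y) ⊙ up W.dl) * D.azt X Y W.A W.A

@[simp] lemma dom_chi (X Y : M) : dom (W.chi X Y) = some (D.bu X Y) := by simp [chi]

@[simp] lemma cod_chi (X Y : M) :
    cod (W.chi X Y) = some (D.bu (D.co X W.A) (D.co Y W.A)) := by simp [chi]

@[simp] lemma dom_psi (X Y : M) : dom (W.psi X Y) = some (D.co (D.bu X Y) W.A) := by simp [psi]

@[simp] lemma cod_psi (X Y : M) :
    cod (W.psi X Y) = some (D.bu (D.co X W.A) (D.co Y W.A)) := by simp [psi]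

lemma dlEta_mul (a : Arr M) : W.dlEta * a = up W.eta * (up W.dl * a) := by
  rw [dlEta, up_comp, mul_assoc]

lemma up_dl_mul_coassoc :
    up W.dl * (up W.dl ⊡ one W.A) = up W.dl * (one W.A ⊡ up W.dl) := by
  have h := congrArg up W.dl_coassoc
  simp only [up_comp, up_eqToHom, D.up_buh, up_id] at h
  rwa [mul_one_of_cod (by simp)] at h

lemma dlEta_mul_coassoc :
    W.dlEta * (up W.dl ⊡ one W.A) = W.dlEta * (one W.A ⊡ up W.dl) := by
  rw [dlEta_mul, dlEta_mul, up_dl_mul_coassoc]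

lemma chi_nat {f g : Arr M} {X X' Y Y' : M} (hX : dom f = some X) (hX' : cod f = some X')
    (hY : dom g = some Y) (hY' : cod g = some Y') :
    (f ⊡ g) * W.chi X' Y' = W.chi X Y * ((f ⊙ one W.A) ⊡ (g ⊙ one W.A)) := by
  rw [chi, chi, mul_assoc, ← D.azt_nat hX hX' hY hY' (h := one W.A) (k := one W.A) rfl rfl rfl rfl,
    ← D.one_bu, ← mul_assoc, ← mul_assoc, D.mul_one_aco (by simp [hX', hY']) rfl,
    D.one_aco_mul_aco_one (by simp [hX, hY]) rfl]

lemma chi_nat_right {g : Arr M} {X Y Y' : M} (hY : dom g = some Y) (hY' : cod g = some Y') :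
    (one X ⊡ g) * W.chi X Y' = W.chi X Y * (one (D.co X W.A) ⊡ (g ⊙ one W.A)) := by
  rw [W.chi_nat rfl rfl hY hY', D.one_co]

lemma chi_uJ_nat {g : Arr M} {Y Y' : M} (hY : dom g = some Y) (hY' : cod g = some Y') :
    g * W.chi D.uJ Y' = W.chi D.uJ Y * (one (D.co D.uJ W.A) ⊡ (g ⊙ one W.A)) := by
  rw [← W.chi_nat_right hY hY', D.one_abu]

lemma chi_mul_psi_abu (X Y : M) :
    W.chi X Y * (W.psi D.uJ X ⊡ one (D.co Y W.A))
      = (one (D.bu X Y) ⊙ (W.dlEta * (up W.dl ⊡ one W.A)))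
        * (D.azt X Y (D.bu W.A W.A) W.A * (D.azt D.uJ X W.A W.A ⊡ one (D.co Y W.A))) := by
  rw [psi, D.mul_abu_one _ (by simp), chi, D.one_co Y, D.buL, mul_assoc,
    ← mul_assoc (D.azt _ _ _ _), ← mul_assoc,
    D.one_aco_mul_azt_mul (by simp) rfl rfl rfl rfl, mul_assoc]

/-- Coassociativity, in the form `1₁ ⊗ 1₂ ⊗ x1₃ ⊗ y1₄`. -/
lemma chi_mul_psi_abu_eq (X Y : M) :
    W.chi X Y * (W.psi D.uJ X ⊡ one (D.co Y W.A))
      = W.chi D.uJ (D.bu X Y) * (one (D.co D.uJ W.A) ⊡ W.psi X Y) := by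
  have h := D.azt_assoc_bu D.uJ X Y W.A W.A W.A
  rw [D.buL] at h
  rw [chi_mul_psi_abu, h, dlEta_mul_coassoc, psi, D.one_abu_mul _ (by simp), chi, D.one_co D.uJ,
    mul_assoc, ← mul_assoc (D.azt _ _ _ _), ← mul_assoc, ← mul_assoc,
    D.one_aco_mul_azt_mul (by simp) rfl rfl rfl rfl, D.buL, mul_assoc]

lemma chi_mul_one_abu_mu_aux :
    (one (D.bu D.uI W.A) ⊙ up D.dlI) * ((one (D.bu D.uI W.A) ⊙ (one D.uI ⊡ W.dlEta))
        * (D.azt D.uI W.A (D.bu D.uI W.A) W.A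
          * ((one (D.bu D.uI W.A) ⊡ up W.mu) * ((up D.tau ⊡ one W.A) ⊡ one W.A))))
      = W.chi D.uI W.A * (one W.A ⊡ up W.mu) := by
  have h := D.one_aco_mul_azt_mul (X := D.uI) (Y := W.A)
    (w := up D.dlI * (one D.uI ⊡ W.dlEta)) (x := up D.tau ⊡ one W.A) (y := one W.A)
    (P := D.bu D.uI W.A) (Q := W.A) (P' := W.A) (Q' := W.A)
    (by simp) (by simp) (by simp) rfl rfl
  rw [mul_assoc (up D.dlI), D.abu_assoc, ← D.one_bu, D.dlI_mul_one_abu_mul rfl (by simp),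
    ← D.one_co, D.one_aco] at h
  rw [D.one_abu_mul_abu_one (by simp) rfl,
    ← D.abu_one_mul_one_abu (a := up D.tau ⊡ one W.A) (b := up W.mu) (X := W.A) (by simp) rfl,
    chi, ← h, D.one_aco_mul _ (by simp)]
  simp only [mul_assoc]

/-- Axiom (RRU) with the superfluous unit `I` removed. -/
lemma rru_arr :
    (up D.dlI * (one D.uI ⊡ W.dlEta)) * ((W.chi D.uI W.A * (one W.A ⊡ up W.mu)) ⊡ one W.A)
      = W.dlEta * (one W.A ⊡ up W.dl) := by
  have h := congrArg up W.rru
  have hu : up W.eta * up W.dl = W.dlEta := (up_comp _ _).symm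
  simp only [up_comp, up_eqToHom, D.up_buh, D.up_coh, up_id, hu] at h
  rw [one_mul_mul_of_dom (by simp), one_mul_mul_of_dom (by simp), one_mul_mul_of_dom (by simp),
    one_mul_of_dom (by simp), mul_one_of_cod (by simp),
    ← mul_assoc (one D.uI ⊡ up W.eta), ← D.one_abu_mul _ (by simp), hu] at h
  have h' := congrArg (· * (up D.tau ⊡ one (D.bu W.A (D.bu W.A W.A)))) h
  simp only [mul_assoc] at h'
  rw [D.one_bu D.uI, D.abu_assoc (one D.uI) (one W.A) (up W.dl),
    ← mul_assoc (one D.uI ⊡ W.dlEta) (one D.uI ⊡ _), ← D.one_abu_mul _ (by simp),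
    D.dlI_mul_one_abu_mul (by simp) (by simp), D.one_bu W.A, D.one_bu W.A, ← D.abu_assoc,
    ← D.abu_assoc, ← D.mul_abu_one _ (by simp), ← D.one_bu D.uI] at h'
  change _ * (_ * (_ * (_ * (D.azt _ _ _ _ ⊡ _ * _)))) = _ at h'
  rw [← D.mul_abu_one _ (by simp), ← D.mul_abu_one _ (by simp),
    ← D.mul_abu_one _ (by simp (maxDischargeDepth := 8)),
    W.chi_mul_one_abu_mu_aux] at h'
  rw [← h', mul_assoc]

/-- The morphism `1₁ ⊗ x ⊗ a1₂` on `X∘A`. -/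
noncomputable def freeChi (X : M) : Arr M :=
  W.chi D.uJ (D.co X W.A) * (one (D.co D.uJ W.A) ⊡ (one X ⊙ up W.mu))

@[simp] lemma dom_freeChi (X : M) : dom (W.freeChi X) = some (D.co X W.A) := by simp [freeChi]

@[simp] lemma cod_freeChi (X : M) :
    cod (W.freeChi X) = some (D.bu (D.co D.uJ W.A) (D.co X W.A)) := by simp [freeChi]

lemma azt_mul_freeChi (X : M) :
    D.azt D.uJ X D.uI W.A * W.freeChi X
      = (one X ⊙ (W.chi D.uI W.A * (one W.A ⊡ up W.mu))) * D.azt D.uJ X W.A W.A := by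
  have h₁ := D.azt_nat (f := one D.uJ) (g := one X) (h := one W.A) (k := up W.mu)
    rfl rfl rfl rfl rfl rfl rfl rfl
  rw [D.one_abu, ← D.one_co] at h₁
  have h₂ := D.azt_assoc_co D.uJ X D.uI W.A W.A W.A
  rw [D.buL, D.coL, D.coR] at h₂
  rw [D.one_aco_mul _ (by simp), mul_assoc, h₁, chi, D.one_aco_mul _ (by simp), mul_assoc,
    ← mul_assoc (_ ⊙ D.azt _ _ _ _), ← h₂, mul_assoc, ← mul_assoc, ← D.aco_assoc, ← D.one_co,
    D.one_aco_mul_aco_one (by simp) rfl, freeChi, chi, mul_assoc, ← mul_assoc, D.buL,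
    D.mul_one_aco (by simp) rfl]

lemma one_aco_mul_azt_mul_azt_abu (X Y : M) :
    (one (D.bu X Y) ⊙ (up D.dlI * (one D.uI ⊡ W.dlEta)))
        * (D.azt X Y (D.bu D.uI W.A) W.A * (D.azt D.uJ X D.uI W.A ⊡ one (D.co Y W.A)))
      = W.chi X Y := by
  have h := D.azt_assoc_bu D.uJ X Y D.uI W.A W.A
  rw [D.buL, D.coR, D.one_abu] at h
  have h₂ := D.azt_nat (f := one D.uJ) (g := one (D.bu X Y)) (h := one D.uI) (k := W.dlEta)
    rfl rfl rfl rfl rfl rfl rfl rfl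
  have h₃ := D.aco_dlI_mul_azt D.uJ (D.bu X Y)
  rw [D.one_abu, ← D.one_co, D.coR, D.one_abu] at h₂
  rw [D.buL] at h₃
  rw [h, D.one_aco_mul _ (by simp), mul_assoc, ← mul_assoc (_ ⊙ (_ ⊡ _)), h₂, ← mul_assoc,
    ← mul_assoc, h₃, one_mul_of_dom (by simp), chi]

/-- Axiom (RRU), in the form `1'₁ ⊗ x1₁1'₂ ⊗ y1₂ = 1₁ ⊗ x1₂ ⊗ y1₃`. -/
lemma chi_mul_freeChi_abu (X Y : M) :
    W.chi X Y * (W.freeChi X ⊡ one (D.co Y W.A))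
      = W.chi X Y * (W.psi D.uJ X ⊡ one (D.co Y W.A)) := by
  rw [chi_mul_psi_abu, dlEta_mul_coassoc, ← rru_arr]
  conv_lhs => rw [← W.one_aco_mul_azt_mul_azt_abu X Y]
  rw [mul_assoc, mul_assoc, ← D.mul_abu_one _ (by simp), azt_mul_freeChi,
    D.mul_abu_one _ (by simp), D.one_co Y, ← mul_assoc (D.azt _ _ _ _), ← mul_assoc,
    D.one_aco_mul_azt_mul (P := D.bu D.uI W.A) (P' := D.bu W.A W.A) (by simp) (by simp)
      (by simp) rfl rfl,
    mul_assoc]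

local notation "JA" => D.co D.uJ W.A

/-- The right action `J∘μ` of `A` on `J∘A`. -/
def act : Arr M := one D.uJ ⊙ up W.mu

/-- The counit `ϖ.(J∘ε)` of `J∘A`. -/
noncomputable def counit : Arr M := (one D.uJ ⊙ up W.ep) * up D.pw

/-- The coaction `ζ.(J∘Δ)`. -/
noncomputable def coact : Arr M := W.psi D.uJ D.uJ

/-- The pairing `ϖ.(J∘(ε.μ))` of `J∘A` with `A`. -/
noncomputable def pairing : Arr M := W.act * W.counit

/-- The idempotent `⊓^R_∘`. -/
noncomputable def sq : Arr M := W.chi D.uJ JA * (one JA ⊡ W.pairing)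

/-- The morphism `1₁ ⊗ x1₂`. -/
noncomputable def actChi : Arr M := W.chi D.uJ JA * (one JA ⊡ W.act)

@[simp] lemma dom_act : dom W.act = some (D.co D.uJ (D.co W.A W.A)) := by simp [act]
@[simp] lemma cod_act : cod W.act = some JA := by simp [act]
@[simp] lemma dom_counit : dom W.counit = some JA := by simp [counit]
@[simp] lemma cod_counit : cod W.counit = some D.uJ := by simp [counit]
@[simp] lemma dom_coact : dom W.coact = some JA := by simp [coact]
@[simp] lemma cod_coact : cod W.coact = some (D.bu JA JA) := by simp [coact]
@[simp] lemma dom_pairing : dom W.pairing = some (D.co D.uJ (D.co W.A W.A)) := by simp [pairing]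
@[simp] lemma cod_pairing : cod W.pairing = some D.uJ := by simp [pairing]
@[simp] lemma dom_sq : dom W.sq = some JA := by simp [sq]
@[simp] lemma cod_sq : cod W.sq = some JA := by simp [sq]
@[simp] lemma dom_actChi : dom W.actChi = some JA := by simp [actChi]
@[simp] lemma cod_actChi : cod W.actChi = some (D.bu JA JA) := by simp [actChi]

lemma act_assoc : (W.act ⊙ one W.A) * W.act = (one JA ⊙ up W.mu) * W.act := by
  have h := congrArg up W.mu_assoc
  simp only [up_comp, up_eqToHom, D.up_coh, up_id] at h
  rw [one_mul_mul_of_dom (by simp)] at h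
  rw [act, D.aco_assoc, ← D.one_aco_mul _ (by simp), h, D.one_aco_mul _ (by simp), D.one_co,
    D.aco_assoc]

lemma one_aco_eta_mul_act : (one JA ⊙ up W.eta) * W.act = one JA := by
  have h := congrArg up W.mu_unitR
  simp only [up_comp, up_eqToHom, D.up_coh, up_id] at h
  rw [one_mul_mul_of_dom (by simp)] at h
  rw [act, D.one_co, D.aco_assoc, ← D.one_aco_mul _ (by simp), h]

lemma coact_mul_counit_abu : W.coact * (W.counit ⊡ one JA) = one JA := by
  have h := congrArg up W.dl_counitL
  simp only [up_comp, up_eqToHom, D.up_buh, up_id] at h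
  rw [mul_one_of_cod (by simp)] at h
  rw [coact, psi, counit, D.mul_abu_one _ (by simp), mul_assoc, ← mul_assoc (D.azt _ _ _ _),
    ← mul_assoc, D.one_co, D.one_aco_mul_azt_mul (by simp) rfl rfl rfl rfl, h, D.buL, ← D.one_co,
    mul_assoc, D.azt_mul_pw_abu, one_mul_of_dom rfl]

/-- Axiom (WB) for the coaction on `J∘A`. -/
lemma act_mul_coact :
    W.act * W.coact = (W.coact ⊙ one W.A) * (W.psi JA JA * (W.act ⊡ W.act)) := by
  have h := congrArg up W.wb
  simp only [up_comp, D.up_coh, D.up_buh] at h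
  change _ = _ * (D.azt _ _ _ _ * _) at h
  have h₁ := D.azt_nat (f := one D.uJ) (g := one D.uJ) (h := up W.mu) (k := up W.mu)
    rfl rfl rfl rfl rfl rfl rfl rfl
  have h₂ := D.azt_assoc_co D.uJ D.uJ W.A W.A W.A W.A
  rw [D.one_abu] at h₁
  rw [D.buL] at h₂
  rw [coact, psi, act, D.buL, ← mul_assoc, ← D.one_aco_mul _ rfl, h, D.one_aco_mul _ (by simp),
    D.one_aco_mul _ (by simp), mul_assoc, mul_assoc, h₁, ← mul_assoc (_ ⊙ D.azt _ _ _ _), ← h₂,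
    mul_assoc, ← mul_assoc, ← D.aco_assoc, D.aco_mul_aco (by simp) (by simp),
    mul_one_of_cod rfl, psi]
  simp only [← mul_assoc]
  rw [D.aco_one_mul_one_aco (by simp) rfl]

lemma coact_mul_chi : W.coact * (W.chi JA JA * (W.act ⊡ W.act)) = W.coact := by
  have h := congrArg ((one JA ⊙ up W.eta) * ·) W.act_mul_coact
  simp only [← mul_assoc] at h
  rw [one_aco_eta_mul_act, one_mul_of_dom (by simp), D.one_aco_mul_aco_one (by simp) rfl, psi,
    ← mul_assoc, ← D.mul_one_aco (X := D.bu JA JA) (by simp) rfl, mul_assoc W.coact,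
    ← D.one_aco_mul _ rfl, ← up_comp] at h
  rw [chi, ← mul_assoc, ← mul_assoc]
  exact h.symm

lemma llc_arr :
    ((W.psi D.uJ JA * (one JA ⊡ W.pairing)) ⊙ one W.A) * W.pairing
      = (one JA ⊙ up W.mu) * W.pairing := by
  have h := congrArg up W.llc
  simp only [up_comp, up_eqToHom, D.up_coh, D.up_buh, up_id] at h
  rw [one_mul_mul_of_dom (by simp), one_mul_mul_of_dom (by simp), one_mul_mul_of_dom (by simp),
    one_mul_mul_of_dom (by simp), one_mul_of_dom (by simp), D.one_aco_mul _ (by simp),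
    mul_assoc] at h
  change _ * ((D.azt _ _ _ _ ⊙ _) * _) = _ * W.pairing at h
  change _ * (_ * (_ * (_ * W.pairing))) = _ at h
  simp only [← mul_assoc] at h
  rw [← D.mul_aco_one _ (by simp), ← D.mul_aco_one _ (by simp), ← D.mul_aco_one _ (by simp),
    mul_assoc (_ * D.azt _ _ _ _), ← D.one_abu_mul _ (by simp)] at h
  rw [← h, psi, D.buL, pairing, act, counit]
  simp only [mul_assoc]

lemma lrc_arr :
    ((W.psi JA D.uJ * (W.pairing ⊡ one JA)) ⊙ one W.A) * W.pairing
      = (one JA ⊙ up W.mu) * W.pairing := by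
  have h := congrArg up W.lrc
  simp only [up_comp, up_eqToHom, D.up_coh, D.up_buh, up_id] at h
  rw [one_mul_mul_of_dom (by simp), one_mul_mul_of_dom (by simp), one_mul_mul_of_dom (by simp),
    one_mul_mul_of_dom (by simp), one_mul_of_dom (by simp), D.one_aco_mul _ (by simp),
    mul_assoc] at h
  change _ * ((D.azt _ _ _ _ ⊙ _) * _) = _ * W.pairing at h
  change _ * (_ * (_ * (_ * W.pairing))) = _ at h
  simp only [← mul_assoc] at h
  rw [← D.mul_aco_one _ (by simp), ← D.mul_aco_one _ (by simp), ← D.mul_aco_one _ (by simp),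
    mul_assoc (_ * D.azt _ _ _ _), ← D.mul_abu_one _ (by simp)] at h
  rw [← h, psi, D.buR, pairing, act, counit]
  simp only [mul_assoc]

lemma sq_aco_mul_pairing : (W.sq ⊙ one W.A) * W.pairing = W.pairing := by
  have h := congrArg (((one JA ⊙ up W.eta) ⊙ one W.A) * ·) W.llc_arr
  simp only [← mul_assoc] at h
  rw [← D.mul_aco_one _ (by simp), psi, D.buL, ← mul_assoc, ← mul_assoc,
    ← D.one_aco_mul _ rfl, ← up_comp] at h
  have h' := congrArg up W.mu_unitL
  simp only [up_comp, up_eqToHom, D.up_coh, up_id] at h'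
  rw [one_mul_mul_of_dom (by simp)] at h'
  rw [sq, chi, D.buL, dlEta, h, D.aco_assoc, ← D.one_aco_mul _ (by simp), h', ← D.one_co,
    one_mul_of_dom (by simp)]

lemma mul_sq_congr {f g : Arr M} {Z : M} (hf : dom f = some Z) (hf' : cod f = some JA)
    (hg : dom g = some Z) (hg' : cod g = some JA)
    (h : (f ⊙ one W.A) * W.pairing = (g ⊙ one W.A) * W.pairing) : f * W.sq = g * W.sq := by
  rw [sq, ← mul_assoc, ← mul_assoc, W.chi_uJ_nat hf hf', W.chi_uJ_nat hg hg', mul_assoc, mul_assoc,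
    ← D.one_abu_mul _ (by simp [hf']), ← D.one_abu_mul _ (by simp [hg']), h]

lemma act_aco_mul_pairing :
    (W.act ⊙ one W.A) * W.pairing = (one JA ⊙ up W.mu) * W.pairing := by
  rw [pairing, ← mul_assoc, act_assoc, mul_assoc]

lemma sq_aco_mul_act_mul_sq : (W.sq ⊙ one W.A) * (W.act * W.sq) = W.act * W.sq := by
  rw [← mul_assoc]
  refine W.mul_sq_congr (Z := D.co D.uJ (D.co W.A W.A)) (by simp) (by simp) (by simp) (by simp) ?_
  rw [D.mul_aco_one _ (by simp), mul_assoc, act_aco_mul_pairing, ← mul_assoc, D.aco_assoc,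
    ← D.one_co, D.aco_one_mul_one_aco (Y := D.co W.A W.A) (by simp) rfl,
    ← D.one_aco_mul_aco_one (X := JA) (Y := W.A) (by simp) rfl, mul_assoc, sq_aco_mul_pairing]

lemma psi_mul_pairing_abu_mul_sq :
    W.psi JA D.uJ * (W.pairing ⊡ one JA) * W.sq = W.act * W.sq := by
  refine W.mul_sq_congr (Z := D.co D.uJ (D.co W.A W.A)) (by simp) (by simp) (by simp) (by simp) ?_
  rw [lrc_arr, act_aco_mul_pairing]

lemma actChi_mul_counit : W.actChi * (one JA ⊡ W.counit) = W.sq := by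
  rw [actChi, mul_assoc, ← D.one_abu_mul _ (by simp), sq, pairing]

lemma freeChi_mul_act :
    W.freeChi JA * (one JA ⊡ W.act) = W.act * W.actChi := by
  rw [freeChi, mul_assoc, ← D.one_abu_mul _ (by simp), ← act_assoc, actChi, ← mul_assoc,
    W.chi_uJ_nat (Y := D.co JA W.A) (by simp) (by simp), mul_assoc, ← D.one_abu_mul _ (by simp)]

lemma freeChi_uJ : W.freeChi D.uJ = W.actChi := rfl

lemma sq_mul_coact : W.sq * W.coact = W.sq * W.actChi := by
  have h := W.chi_mul_freeChi_abu D.uJ JA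
  rw [freeChi_uJ] at h
  rw [sq, mul_assoc, mul_assoc, D.one_abu_mul_eq (by simp) (by simp),
    D.one_abu_mul_eq (by simp) (by simp),
    ← D.abu_one_mul_one_abu (a := W.coact) (Y := D.co JA W.A) W.cod_coact (by simp),
    ← D.abu_one_mul_one_abu (a := W.actChi) (Y := D.co JA W.A) W.cod_actChi (by simp),
    ← mul_assoc, ← mul_assoc, h, coact]

lemma actChi_mul_one_abu_sq :
    W.actChi * (one JA ⊡ W.sq) = W.chi D.uJ JA * (one JA ⊡ (W.act * W.sq)) := by
  rw [actChi, mul_assoc, ← D.one_abu_mul _ (by simp)]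

lemma sq_mul_coact_mul_one_abu_sq :
    W.sq * (W.coact * (one JA ⊡ W.sq)) = W.actChi * (one JA ⊡ W.sq) := by
  rw [← mul_assoc, sq_mul_coact, mul_assoc, actChi_mul_one_abu_sq, ← mul_assoc,
    W.chi_uJ_nat (Y := JA) (by simp) (by simp), mul_assoc, ← D.one_abu_mul _ (by simp),
    sq_aco_mul_act_mul_sq]

lemma chi_mul_act_sq_abu {Y : M} {b : Arr M} (hb : dom b = some (D.co Y W.A)) :
    W.chi JA Y * ((W.act * W.sq) ⊡ b)
      = W.chi D.uJ (D.bu JA Y) * (one JA ⊡ (W.psi JA Y * (W.pairing ⊡ b))) := by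
  have h : W.freeChi JA * (one JA ⊡ W.pairing) = W.act * W.sq := by
    rw [pairing, D.one_abu_mul _ (by simp), ← mul_assoc, freeChi_mul_act, mul_assoc,
      actChi_mul_counit]
  rw [D.one_abu_mul _ (by simp [hb]), ← mul_assoc, ← chi_mul_psi_abu_eq, ← chi_mul_freeChi_abu,
    mul_assoc, ← D.abu_assoc, D.abu_mul_abu (by simp) (by simp [hb]), h, one_mul_of_dom hb]

lemma coact_mul_sq_abu_sq : W.coact * (W.sq ⊡ W.sq) = W.actChi * (one JA ⊡ W.sq) := by
  have h : W.act * W.sq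
      = (W.coact ⊙ one W.A) * (W.psi JA JA * (W.pairing ⊡ (W.act * W.sq))) := by
    conv_lhs => rw [← one_mul_of_dom W.dom_sq, ← coact_mul_counit_abu]
    rw [mul_assoc, D.abu_one_mul_eq (by simp) (by simp), ← mul_assoc, act_mul_coact, mul_assoc,
      mul_assoc, D.abu_mul_abu (by simp) (by simp), pairing]
  rw [actChi_mul_one_abu_sq, h, D.one_abu_mul _ (by simp), ← mul_assoc,
    ← W.chi_uJ_nat (Y' := D.bu JA JA) (by simp) (by simp), mul_assoc,
    ← chi_mul_act_sq_abu _ (by simp), ← D.abu_mul_abu (by simp) (by simp), ← mul_assoc, ← mul_assoc, mul_assoc W.coact, coact_mul_chi]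

lemma chi_mul_act_abu_one_mul_sq_abu_sq :
    W.chi JA D.uJ * (W.act ⊡ one JA) * (W.sq ⊡ W.sq) = W.actChi * (one JA ⊡ W.sq) := by
  rw [actChi_mul_one_abu_sq, mul_assoc, D.abu_mul_abu (by simp) (by simp),
    one_mul_of_dom W.dom_sq, chi_mul_act_sq_abu _ (by simp), ← psi_mul_pairing_abu_mul_sq,
    mul_assoc, D.abu_one_mul_eq (by simp) (by simp), D.buR]

lemma up_sqcapR : up W.sqcapR = W.sq := by
  change up (eqToHom (D.coR JA).symm ≫ D.coh (𝟙 JA) (W.eta ≫ W.dl)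
    ≫ eqToHom (show D.co JA (D.bu W.A W.A) = D.co (D.bu D.uJ JA) (D.bu W.A W.A) by simp)
    ≫ D.zt D.uJ JA W.A W.A
    ≫ D.buh (𝟙 JA) (eqToHom (D.coA D.uJ W.A W.A) ≫ D.coh (𝟙 D.uJ) (W.mu ≫ W.ep))
    ≫ D.buh (𝟙 JA) D.pw ≫ eqToHom (D.buR JA)) = _
  simp only [up_comp (M := M), up_eqToHom, D.up_coh, D.up_buh, up_id]
  rw [one_mul_mul_of_dom (by simp), one_mul_mul_of_dom (by simp), one_mul_of_dom (by simp),
    mul_one_of_cod (by simp), ← D.one_abu_mul _ (by simp), sq, chi, pairing, act, counit, dlEta,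
    up_comp, D.one_bu, D.one_abu, D.one_aco_mul D.uJ rfl, mul_assoc, mul_assoc]
  rfl

lemma up_coact0 : up W.coact0 = W.coact := by
  unfold coact0 RWB.JA
  simp only [up_comp (M := M), up_eqToHom, D.up_coh, up_id]
  rw [one_mul_of_dom (by simp), coact, psi, D.one_bu, D.one_abu]
  rfl

lemma up_jeta : up W.jeta = one D.uJ ⊙ up W.eta := by
  unfold jeta RWB.JA
  rw [up_comp, up_eqToHom, one_mul_of_dom (by simp)]
  rfl

lemma one_abu_jeta_mul_chi_mul_act_abu_act :
    (one JA ⊡ up W.jeta) * (W.chi JA JA * (W.act ⊡ W.act))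
      = W.chi JA D.uJ * (W.act ⊡ one JA) := by
  have h := congrArg up W.mu_unitL
  simp only [up_comp, up_eqToHom, D.up_coh, up_id] at h
  rw [one_mul_mul_of_dom (by simp)] at h
  rw [← mul_assoc, W.chi_nat_right (Y := D.uJ) (by simp [up_jeta]) (by simp [up_jeta]), mul_assoc,
    D.abu_mul_abu (by simp) (by simp [up_jeta]), one_mul_of_dom (by simp), up_jeta, act,
    D.aco_assoc, ← D.one_aco_mul _ (by simp), h, D.one_co]

section Retract

variable {R : M} {p : W.JA ⟶ R} {i : R ⟶ W.JA}

lemma up_DeltaR : up (W.DeltaR R p i)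
    = (one R ⊡ (up W.jeta * up p)) * (W.chi R R * (up (W.gamA R p i) ⊡ up (W.gamA R p i))) := by
  rw [DeltaR, chiR]
  simp only [up_comp (M := M), up_eqToHom, D.up_coh, D.up_buh, up_id]
  rw [one_mul_mul_of_dom (by simp), one_mul_mul_of_dom (by simp), chi, mul_assoc, ← mul_assoc,
    ← D.one_abu_mul _ rfl, dlEta, up_comp]
  rfl

lemma up_gamA : up (W.gamA R p i) = (up i ⊙ one W.A) * (W.act * up p) := by
  refine (up_comp _ _).trans (congrArg _ ((up_comp _ _).trans ?_))
  exact (congrArg (· * _) (up_eqToHom (D.coA D.uJ W.A W.A))).trans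
    ((one_mul_of_dom (by rw [dom_up, D.coA])).trans (up_comp _ _))

@[simp] lemma dom_gamA : dom (up (W.gamA R p i)) = some (D.co R W.A) := rfl

lemma mul_up_DeltaR_mul (hpi : up p * up i = W.sq) :
    up p * (up (W.DeltaR R p i) * (up i ⊡ up i)) = W.actChi * (one JA ⊡ W.sq) := by
  have hp : dom (up p) = some JA := rfl
  have hi : cod (up i) = some JA := rfl
  have hγ : (up p ⊙ one W.A) * (up (W.gamA R p i) * up i) = W.act * W.sq := by
    rw [up_gamA, mul_assoc, mul_assoc, hpi, ← mul_assoc, ← D.mul_aco_one _ (by simp), hpi,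
      sq_aco_mul_act_mul_sq]
  rw [up_DeltaR, mul_assoc, mul_assoc, D.abu_mul_abu (by simp) (by simp), ← mul_assoc,
    D.mul_one_abu_eq (by simp) (by simp [up_jeta, hp])]
  rw [← one_mul_of_dom hp, ← D.abu_mul_abu (by simp [hp]) (by simp [up_jeta, hp]),
    one_mul_of_dom hp, mul_assoc, ← mul_assoc (up p ⊡ up p), W.chi_nat hp rfl hp rfl, mul_assoc,
    D.abu_mul_abu (by simp) (by simp), hγ, ← D.abu_mul_abu (by simp) (by simp),
    ← mul_assoc (W.chi JA JA), ← mul_assoc, one_abu_jeta_mul_chi_mul_act_abu_act,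
    chi_mul_act_abu_one_mul_sq_abu_sq]

end Retract

end RWB

/-- **Statement 6.**  For a right weak bimonoid `A` in a duoidal category with split
idempotents and a fixed splitting `⊓^R_∘ = ι^R_∘.π^R_∘` through `R_∘`:
`⊓^R_∘` is a morphism of right `R_∘`-comodules, hence so are `π^R_∘` and `ι^R_∘`,
and `Δ^R_∘ = (π^R_∘•π^R_∘).ζ.(J∘Δ).ι^R_∘`. -/
theorem sqcapR_right_comodule_morphism
    {M : Type u} [Category.{v} M] (D : Duo M) (W : RWB D)
    (hsplit : SplitIdem M)
    (R : M) (p : W.JA ⟶ R) (i : R ⟶ W.JA)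
    (hpi : p ≫ i = W.sqcapR) (hip : i ≫ p = 𝟙 R) :
    -- `⊓^R_∘` is a morphism of right `R_∘`-comodules:
    (W.sqcapR ≫ W.coact0 ≫ D.buh (𝟙 W.JA) W.sqcapR
        = W.coact0 ≫ D.buh (𝟙 W.JA) W.sqcapR ≫ D.buh W.sqcapR (𝟙 W.JA)) ∧
    -- hence `π^R_∘` is a morphism of right `R_∘`-comodules …
    (p ≫ W.DeltaR R p i = (W.coact0 ≫ D.buh (𝟙 W.JA) p) ≫ D.buh p (𝟙 R)) ∧
    -- … and so is `ι^R_∘` …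
    (i ≫ W.coact0 ≫ D.buh (𝟙 W.JA) p = W.DeltaR R p i ≫ D.buh i (𝟙 R)) ∧
    -- … and moreover `Δ^R_∘ = (π^R_∘•π^R_∘).ζ.(J∘Δ).ι^R_∘`.
    (W.DeltaR R p i = i ≫ W.coact0 ≫ D.buh p p) := by
  have hE : Arr.up p * Arr.up i = W.sq := by rw [← Arr.up_comp, hpi, W.up_sqcapR]
  have hR : Arr.up i * Arr.up p = Arr.one R := by rw [← Arr.up_comp, hip, Arr.up_id]
  have hp : Arr.dom (Arr.up p) = some (D.co D.uJ W.A) := rfl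
  have hi : Arr.cod (Arr.up i) = some (D.co D.uJ W.A) := rfl
  have hEp : W.sq * Arr.up p = Arr.up p := by
    rw [← hE, mul_assoc, hR, Arr.mul_one_of_cod rfl]
  have hiE : Arr.up i * W.sq = Arr.up i := by
    rw [← hE, ← mul_assoc, hR, Arr.one_mul_of_dom rfl]
  have hΔ : Arr.up p * Arr.up (W.DeltaR R p i)
      = W.coact * D.abu (Arr.up p) (Arr.up p) := by
    have h := W.mul_up_DeltaR_mul hE
    rw [← W.coact_mul_sq_abu_sq] at h
    have h' := congrArg (· * D.abu (Arr.up p) (Arr.up p)) h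
    simp only [mul_assoc] at h'
    rwa [D.abu_mul_abu rfl rfl, hR, ← D.one_bu, Arr.mul_one_of_cod rfl,
      D.abu_mul_abu (by simp [hp]) (by simp [hp]), hEp] at h'
  have hΔ' : Arr.up (W.DeltaR R p i)
      = Arr.up i * (W.coact * D.abu (Arr.up p) (Arr.up p)) := by
    rw [← hΔ, ← mul_assoc, hR, Arr.one_mul_of_dom rfl]
  have hι : Arr.up i * (W.coact * D.abu (Arr.one (D.co D.uJ W.A)) (Arr.up p))
      = Arr.up i * (W.coact * D.abu W.sq (Arr.up p)) := by
    have h := W.sq_mul_coact_mul_one_abu_sq.trans W.coact_mul_sq_abu_sq.symm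
    have h' := congrArg (Arr.up i * · * D.abu (Arr.one (D.co D.uJ W.A)) (Arr.up p)) h
    simp only [mul_assoc] at h'
    rwa [← mul_assoc, hiE, D.abu_mul_abu rfl (by simp [hp]),
      D.abu_mul_abu (by simp) (by simp [hp]), hEp, Arr.mul_one_of_cod rfl,
      Arr.mul_one_of_cod W.cod_sq] at h'
  refine ⟨Arr.up_injective ?_, Arr.up_injective ?_, Arr.up_injective ?_, Arr.up_injective ?_⟩
  · simp only [Arr.up_comp, D.up_buh, W.up_sqcapR, W.up_coact0, Arr.up_id]
    refine W.sq_mul_coact_mul_one_abu_sq.trans (W.coact_mul_sq_abu_sq.symm.trans ?_)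
    exact congrArg _ (D.one_abu_mul_abu_one W.dom_sq W.cod_sq).symm
  · simp only [Arr.up_comp, D.up_buh, W.up_coact0, Arr.up_id]
    rw [hΔ, mul_assoc]
    exact congrArg _ (D.one_abu_mul_abu_one hp rfl).symm
  · simp only [Arr.up_comp, D.up_buh, W.up_coact0, Arr.up_id]
    rw [hΔ', mul_assoc, mul_assoc, D.abu_mul_abu rfl rfl, hE, Arr.mul_one_of_cod rfl]
    exact hι
  · simp only [Arr.up_comp, D.up_buh, W.up_coact0]
    exact hΔ'
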